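/- arXiv:2002.11751 — 5 statements merged into one kernel-verified Lean document; each statement's English description precedes it below -/
import Mathlib

section
/- Let U : K₁ ⥤ K₂ be a categorical precompact expansion of categories. If A is an object of K₂ all of whose expansions A^0, …, A^{m(A)−1} in K₁ have finite Ramsey degree in K₁, then the Ramsey degree of A in K₂ satisfies t_{K₂}(A) ≤ Σ_{i < m(A)} t_{K₁}(A^i). -/
open CategoryTheory

universe v₁ v₂ u₁ u₂ v u

namespace CatRamsey

variable {C : Type u} [Category.{v} C]

/-- Two morphisms `f, h : A ⟶ B` are equivalent if `f ∘ g = h` for some automorphism `g` of `A`. -/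
def copySetoid (A B : C) : Setoid (A ⟶ B) where
  r f h := ∃ g : A ≅ A, g.hom ≫ f = h
  iseqv := by
    constructor
    · intro f
      exact ⟨Iso.refl A, by simp⟩
    · rintro f h ⟨g, hg⟩
      refine ⟨g.symm, ?_⟩
      rw [← hg, ← Category.assoc, Iso.symm_hom, g.inv_hom_id, Category.id_comp]
    · rintro f h k ⟨g₁, h₁⟩ ⟨g₂, h₂⟩
      exact ⟨g₂ ≪≫ g₁, by rw [Iso.trans_hom, Category.assoc, h₁, h₂]⟩

/-- The set of copies of `A` in `B`: `Hom(A,B)` modulo precomposition with automorphisms. -/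
def Copies (A B : C) := Quotient (copySetoid A B)

/-- The copy determined by a morphism. -/
def copyMk {A B : C} (f : A ⟶ B) : Copies A B := Quotient.mk (copySetoid A B) f

/-- `D → (B)^A_{k,t}` : for every colouring `χ` of the copies of `A` in `D` with `k` colours,
there is `f : B ⟶ D` such that `χ` takes at most `t` values on the copies of `A` in the
image of `B` under `f`. -/
def ArrowsRamsey (A B D : C) (k t : ℕ) : Prop :=
  ∀ χ : Copies A D → Fin k, ∃ f : B ⟶ D,
    (χ '' {c : Copies A D | ∃ h : A ⟶ B, c = copyMk (h ≫ f)}).ncard ≤ t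

/-- The Ramsey degree of `A` in `C` : the least `t` such that for every `B` and every number
of colours `k` there is a `D` with `D → (B)^A_{k,t}`; `⊤` if no such `t` exists. -/
noncomputable def ramseyDegree (A : C) : ℕ∞ :=
  sInf {t : ℕ∞ | ∃ t' : ℕ, t = (t' : ℕ∞) ∧ ∀ (B : C) (k : ℕ), ∃ D : C, ArrowsRamsey A B D k t'}

/-- An expansion functor: faithful (C), surjective on objects (Proj), and satisfying the
reflection condition (Ref) with a unique reflecting expansion. -/
def IsExpansionFunctor {K₁ : Type u₁} {K₂ : Type u₂} [Category.{v₁} K₁] [Category.{v₂} K₂]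
    (U : K₁ ⥤ K₂) : Prop :=
  (∀ (A B : K₁), Function.Injective (fun f : A ⟶ B => U.map f)) ∧
  (∀ A : K₂, ∃ A' : K₁, U.obj A' = A) ∧
  (∀ (A B : K₂) (f : A ⟶ B) (B' : K₁) (hB : U.obj B' = B),
    ∃ (A' : K₁) (hA : U.obj A' = A),
      (∃ (f' : A' ⟶ B') (g : A ≅ A), g.hom ≫ eqToHom hA.symm ≫ U.map f' ≫ eqToHom hB = f) ∧
      ∀ (A'' : K₁) (hA' : U.obj A'' = A),
        (∃ (f' : A'' ⟶ B') (g : A ≅ A),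
          g.hom ≫ eqToHom hA'.symm ≫ U.map f' ≫ eqToHom hB = f) → A'' = A')

/-- A categorical precompact expansion: an expansion functor all of whose fibres on objects
are finite. -/
def IsPrecompactExpansion {K₁ : Type u₁} {K₂ : Type u₂} [Category.{v₁} K₁] [Category.{v₂} K₂]
    (U : K₁ ⥤ K₂) : Prop :=
  IsExpansionFunctor U ∧ ∀ A : K₂, Finite {A' : K₁ // U.obj A' = A}

end CatRamsey

open CatRamsey

namespace CatRamsey

variable {C : Type u} [Category.{v} C]

theorem copyMk_iso_comp {A B : C} (g : A ≅ A) (f : A ⟶ B) :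
    copyMk (g.hom ≫ f) = copyMk f :=
  (Quotient.sound (s := copySetoid A B) ⟨g, rfl⟩).symm

theorem image_copies_eq_range {α : Type*} {A B D : C} (χ : Copies A D → α) (f : B ⟶ D) :
    χ '' {c : Copies A D | ∃ h : A ⟶ B, c = copyMk (h ≫ f)} =
      Set.range fun h : A ⟶ B => χ (copyMk (h ≫ f)) := by
  ext x
  constructor
  · rintro ⟨_, ⟨h, rfl⟩, rfl⟩
    exact ⟨h, rfl⟩
  · rintro ⟨h, rfl⟩
    exact ⟨_, ⟨h, rfl⟩, rfl⟩

theorem exists_arrowsRamsey_of_ramseyDegree_ne_top {A : C} (hA : ramseyDegree A ≠ ⊤) :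
    ∃ t : ℕ, ramseyDegree A = t ∧ ∀ (B : C) (k : ℕ), ∃ D : C, ArrowsRamsey A B D k t := by
  refine csInf_mem (s := {t : ℕ∞ | ∃ t' : ℕ, t = (t' : ℕ∞) ∧
    ∀ (B : C) (k : ℕ), ∃ D : C, ArrowsRamsey A B D k t'}) ?_
  by_contra hempty
  rw [Set.not_nonempty_iff_eq_empty] at hempty
  exact hA (by rw [ramseyDegree, hempty, sInf_empty])

theorem ramseyDegree_le_of_arrowsRamsey {A : C} {t : ℕ}
    (h : ∀ (B : C) (k : ℕ), ∃ D : C, ArrowsRamsey A B D k t) : ramseyDegree A ≤ t :=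
  sInf_le ⟨t, rfl, h⟩

/-- The map on copies of `A` induced by postcomposition with `f`. -/
def Copies.map (A : C) {B D : C} (f : B ⟶ D) : Copies A B → Copies A D :=
  Quotient.lift (fun h => copyMk (h ≫ f)) (by
    rintro h _ ⟨g, rfl⟩
    rw [Category.assoc, copyMk_iso_comp])

/-- The map from copies of an expansion `A'` of `A` to copies of `A` induced by a functor. -/
def Copies.mapFunctor {K₁ : Type u₁} {K₂ : Type u₂} [Category.{v₁} K₁] [Category.{v₂} K₂]
    (U : K₁ ⥤ K₂) {A : K₂} {A' : K₁} (hA : U.obj A' = A) (D : K₁) :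
    Copies A' D → Copies A (U.obj D) :=
  Quotient.lift (fun h => copyMk (eqToHom hA.symm ≫ U.map h)) (by
    rintro h _ ⟨g, rfl⟩
    subst hA
    simpa using (copyMk_iso_comp (U.mapIso g) (U.map h)).symm)

/-- Finitely many objects satisfying a Ramsey arrow can be treated simultaneously. -/
theorem exists_simultaneous_arrowsRamsey {ι : Type*} (A : ι → C) (t : ι → ℕ)
    (hA : ∀ (i : ι) (B : C) (k : ℕ), ∃ D : C, ArrowsRamsey (A i) B D k (t i))
    (s : Finset ι) (B : C) (k : ℕ) :
    ∃ D : C, ∀ χ : ∀ i, Copies (A i) D → Fin k, ∃ f : B ⟶ D, ∀ i ∈ s,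
      (Set.range fun h : A i ⟶ B => χ i (copyMk (h ≫ f))).ncard ≤ t i := by
  classical
  induction s using Finset.induction_on with
  | empty => exact ⟨B, fun _ => ⟨𝟙 B, by simp⟩⟩
  | insert i s _ ih =>
    obtain ⟨D, hD⟩ := ih
    obtain ⟨E, hE⟩ := hA i D k
    refine ⟨E, fun χ => ?_⟩
    obtain ⟨g, hg⟩ := hE (χ i)
    obtain ⟨f, hf⟩ := hD fun j => χ j ∘ Copies.map (A j) g
    rw [image_copies_eq_range] at hg
    refine ⟨f ≫ g, fun j hj => ?_⟩
    rcases Finset.mem_insert.mp hj with rfl | hj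
    · refine (Set.ncard_le_ncard ?_ (Set.toFinite _)).trans hg
      rintro _ ⟨h, rfl⟩
      exact ⟨h ≫ f, by simp⟩
    · have hmap (h : A j ⟶ B) :
          Copies.map (A j) g (copyMk (h ≫ f)) = copyMk (h ≫ f ≫ g) :=
        congrArg copyMk (Category.assoc h f g)
      simpa only [Function.comp_apply, hmap] using hf j hj

end CatRamsey

/-- If `U : K₁ ⥤ K₂` is a categorical precompact expansion and all the
expansions `A^0, …, A^{m(A)-1}` of `A` have finite Ramsey degree in `K₁`, then
`t_{K₂}(A) ≤ ∑_{i < m(A)} t_{K₁}(A^i)`. -/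
theorem ramseyDegree_le_sum_of_precompactExpansion
    {K₁ : Type u₁} {K₂ : Type u₂} [Category.{v₁} K₁] [Category.{v₂} K₂]
    (U : K₁ ⥤ K₂) (hU : IsPrecompactExpansion U)
    (A : K₂) (m : ℕ) (e : Fin m ≃ {A' : K₁ // U.obj A' = A})
    (hfin : ∀ i : Fin m, ramseyDegree ((e i : {A' : K₁ // U.obj A' = A}) : K₁) ≠ ⊤) :
    ramseyDegree A ≤ ∑ i : Fin m, ramseyDegree ((e i : {A' : K₁ // U.obj A' = A}) : K₁) := by
  choose t ht hA using fun i => exists_arrowsRamsey_of_ramseyDegree_ne_top (hfin i)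
  simp only [ht]
  rw [← Nat.cast_sum]
  refine ramseyDegree_le_of_arrowsRamsey fun B k => ?_
  obtain ⟨⟨-, hproj, href⟩, -⟩ := hU
  obtain ⟨B', rfl⟩ := hproj B
  obtain ⟨D, hD⟩ := exists_simultaneous_arrowsRamsey _ t hA Finset.univ B' k
  refine ⟨U.obj D, fun χ => ?_⟩
  obtain ⟨f, hf⟩ := hD fun i => χ ∘ Copies.mapFunctor U (e i).2 D
  refine ⟨U.map f, ?_⟩
  rw [image_copies_eq_range]
  refine (Set.ncard_le_ncard (t := ⋃ i, Set.range fun h : (e i : K₁) ⟶ B' =>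
    (χ ∘ Copies.mapFunctor U (e i).2 D) (copyMk (h ≫ f))) ?_ (Set.toFinite _)).trans
    ((Set.ncard_iUnion_le_of_fintype _).trans
      (Finset.sum_le_sum fun i _ => hf i (Finset.mem_univ i)))
  rintro _ ⟨h, rfl⟩
  obtain ⟨A', hA', ⟨h', g, rfl⟩, -⟩ := href A (U.obj B') h B' rfl
  obtain ⟨i, hi⟩ := e.surjective ⟨A', hA'⟩
  refine Set.mem_iUnion.mpr ⟨i, ?_⟩
  rw [hi]
  refine ⟨h', ?_⟩
  change χ (copyMk (eqToHom hA'.symm ≫ U.map (h' ≫ f))) = _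
  simp only [eqToHom_refl, Category.comp_id, Category.assoc, copyMk_iso_comp, U.map_comp]
end

section
/- Let U : K₁ ⥤ K₂ be a functor between categories such that: (a) for every object A of K₂, the collection of objects A* of K₁ with U(A*) = A is finite and nonempty; and (b) for every morphism f : A ⟶ B in K₂ and every object B* of K₁ with U(B*) = B, there exist an object A* of K₁ with U(A*) = A, a morphism f* : A* ⟶ B*, and an automorphism g of A such that U(f*) ∘ g = f. Then for every functor F : ℕ ⥤ K₂ (where ℕ carries its usual order, regarded as a category) there exist a functor G : ℕ ⥤ K₁ and automorphisms ι_n of F(n) for each n ∈ ℕ such that U(G(n)) = F(n) for all n and U(G(n ⟶ n+1)) ∘ ι_n = F(n ⟶ n+1) for all n, where n ⟶ n+1 denotes the morphism of ℕ from n to n+1. -/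
open CategoryTheory

universe v₁ v₂ u₁ u₂

/-- **Kőnig's lemma** for inverse sequences of finite nonempty types. -/
theorem exists_coherent_sequence {X : ℕ → Type*} (hfin : ∀ n, Finite (X n))
    (hne : ∀ n, Nonempty (X n)) (p : ∀ n, X (n + 1) → X n) :
    ∃ u : ∀ n, X n, ∀ n, p n (u (n + 1)) = u n := by
  let S : ℕᵒᵖ ⥤ Type _ := Functor.ofOpSequence (X := X) fun n ↦ ↾(p n)
  have (j : ℕᵒᵖ) : Finite (S.obj j) := hfin j.unop
  have (j : ℕᵒᵖ) : Nonempty (S.obj j) := hne j.unop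
  obtain ⟨s, hs⟩ := nonempty_sections_of_finite_cofiltered_system S
  refine ⟨fun n ↦ s (.op n), fun n ↦ ?_⟩
  have h := hs (homOfLE (Nat.le_succ n)).op
  rw [Functor.ofOpSequence_map_homOfLE_succ] at h
  exact h

/-- **lifting lemma.** Let `U : K₁ ⥤ K₂` be a functor such that (a) every
object of `K₂` has a finite nonempty set of preimages and (b) `U` satisfies the reflection
condition.  Then every functor `F : ℕ ⥤ K₂` lifts, up to levelwise automorphisms `ι n` of
`F(n)`, to a functor `G : ℕ ⥤ K₁` with `U(G(n)) = F(n)` and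
`U(G(n ⟶ n+1)) ∘ ι n = F(n ⟶ n+1)` for all `n`. -/
theorem exists_lift_of_sequence
    {K₁ : Type u₁} {K₂ : Type u₂} [Category.{v₁} K₁] [Category.{v₂} K₂]
    (U : K₁ ⥤ K₂)
    (hfib : ∀ A : K₂, Finite {A' : K₁ // U.obj A' = A} ∧ Nonempty {A' : K₁ // U.obj A' = A})
    (href : ∀ (A B : K₂) (f : A ⟶ B) (B' : K₁) (hB : U.obj B' = B),
      ∃ (A' : K₁) (hA : U.obj A' = A) (f' : A' ⟶ B') (g : A ≅ A),
        g.hom ≫ eqToHom hA.symm ≫ U.map f' ≫ eqToHom hB = f) :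
    ∀ F : ℕ ⥤ K₂, ∃ (G : ℕ ⥤ K₁) (h : ∀ n : ℕ, U.obj (G.obj n) = F.obj n)
      (ι : ∀ n : ℕ, F.obj n ≅ F.obj n),
      ∀ n : ℕ,
        (ι n).hom ≫ eqToHom (h n).symm ≫ U.map (G.map (homOfLE (Nat.le_succ n))) ≫
            eqToHom (h (n + 1)) =
          F.map (homOfLE (Nat.le_succ n)) := by
  intro F
  have hlift : ∀ (n : ℕ) (b : {A' : K₁ // U.obj A' = F.obj (n + 1)}),
      ∃ (a : {A' : K₁ // U.obj A' = F.obj n}) (f : a.1 ⟶ b.1) (g : F.obj n ≅ F.obj n),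
        g.hom ≫ eqToHom a.2.symm ≫ U.map f ≫ eqToHom b.2 =
          F.map (homOfLE (Nat.le_succ n)) := by
    rintro n ⟨B', hB⟩
    obtain ⟨A', hA, f, g, h⟩ := href _ _ (F.map (homOfLE (Nat.le_succ n))) B' hB
    exact ⟨⟨A', hA⟩, f, g, h⟩
  choose p hp using hlift
  obtain ⟨u, hu⟩ := exists_coherent_sequence (fun n ↦ (hfib (F.obj n)).1)
    (fun n ↦ (hfib (F.obj n)).2) p
  have hu' : ∀ n, ∃ (f : (u n).1 ⟶ (u (n + 1)).1) (g : F.obj n ≅ F.obj n),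
      g.hom ≫ eqToHom (u n).2.symm ≫ U.map f ≫ eqToHom (u (n + 1)).2 =
        F.map (homOfLE (Nat.le_succ n)) := fun n ↦ hu n ▸ hp n (u (n + 1))
  choose f g hfg using hu'
  refine ⟨Functor.ofSequence f, fun n ↦ (u n).2, g, fun n ↦ ?_⟩
  rw [Functor.ofSequence_map_homOfLE_succ]
  exact hfg n
end

section
/- Let U : K₁ ⥤ K₂ be a faithful functor between categories satisfying the reflection condition: for every morphism f : A ⟶ B in K₂ and every object B* of K₁ with U(B*) = B, there exist an object A* of K₁ with U(A*) = A, a morphism f* : A* ⟶ B*, and an automorphism g of A such that U(f*) ∘ g = f. Let F : ℕ ⥤ K₂ and G : ℕ ⥤ K₁ be functors (ℕ regarded as a category via its usual order) with U(G(n)) = F(n) for all n and U(G(n ⟶ m)) = F(n ⟶ m) for all n ≤ m. Let A be an object of K₂ and let f_n : A ⟶ F(n) be morphisms satisfying F(n ⟶ m) ∘ f_n = f_m for all n ≤ m. Then there exist an object A* of K₁ with U(A*) = A, an automorphism g of A, and morphisms f*_n : A* ⟶ G(n) such that U(f*_n) ∘ g = f_n for all n and G(n ⟶ m) ∘ f*_n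 = f*_m for all n ≤ m. -/
open CategoryTheory

universe v₁ v₂ u₁ u₂

/-- Let `U : K₁ ⥤ K₂` be faithful and satisfy the reflection condition.
Let `F : ℕ ⥤ K₂` and `G : ℕ ⥤ K₁` be diagrams with `U ∘ G = F` (levelwise, via the given
object equalities), let `A` be an object of `K₂` and `f_n : A ⟶ F(n)` a compatible cone.
Then there are an object `A*` over `A`, a single automorphism `g` of `A`, and a compatible
cone `f*_n : A* ⟶ G(n)` with `U(f*_n) ∘ g = f_n` for all `n`. -/
theorem exists_cone_lift
    {K₁ : Type u₁} {K₂ : Type u₂} [Category.{v₁} K₁] [Category.{v₂} K₂]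
    (U : K₁ ⥤ K₂)
    (hfaith : ∀ (X Y : K₁), Function.Injective (fun f : X ⟶ Y => U.map f))
    (href : ∀ (A B : K₂) (f : A ⟶ B) (B' : K₁) (hB : U.obj B' = B),
      ∃ (A' : K₁) (hA : U.obj A' = A) (f' : A' ⟶ B') (g : A ≅ A),
        g.hom ≫ eqToHom hA.symm ≫ U.map f' ≫ eqToHom hB = f)
    (F : ℕ ⥤ K₂) (G : ℕ ⥤ K₁) (hobj : ∀ n : ℕ, U.obj (G.obj n) = F.obj n)
    (hmap : ∀ (n m : ℕ) (hnm : n ≤ m),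
      eqToHom (hobj n).symm ≫ U.map (G.map (homOfLE hnm)) ≫ eqToHom (hobj m) =
        F.map (homOfLE hnm))
    (A : K₂) (f : ∀ n : ℕ, A ⟶ F.obj n)
    (hf : ∀ (n m : ℕ) (hnm : n ≤ m), f n ≫ F.map (homOfLE hnm) = f m) :
    ∃ (A' : K₁) (hA : U.obj A' = A) (g : A ≅ A) (f' : ∀ n : ℕ, A' ⟶ G.obj n),
      (∀ n : ℕ, g.hom ≫ eqToHom hA.symm ≫ U.map (f' n) ≫ eqToHom (hobj n) = f n) ∧
      (∀ (n m : ℕ) (hnm : n ≤ m), f' n ≫ G.map (homOfLE hnm) = f' m) := by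
  obtain ⟨A', hA, f₀, g, h⟩ := href A (F.obj 0) (f 0) (G.obj 0) (hobj 0)
  refine ⟨A', hA, g, fun n => f₀ ≫ G.map (homOfLE n.zero_le), fun n => ?_, fun n m hnm => ?_⟩
  · rw [← hf 0 n n.zero_le, ← hmap 0 n n.zero_le, ← h]
    simp
  · rw [Category.assoc, ← G.map_comp, homOfLE_comp]
end

section
/- Let n ≥ 2 and m ≥ 1 be natural numbers and set N = n·m + 1. For each j < n define the binary relation R_j on ZMod N by R_j(a, b) ⟺ j·m + 1 ≤ (a − b).val ≤ (j+1)·m, where (a − b).val ∈ {0, 1, …, N−1} is the canonical representative. Then a permutation σ of ZMod N satisfies (for all j < n and all a, b ∈ ZMod N, R_j(a,b) ⟺ R_j(σ a, σ b)) if and only if there exists c ∈ ZMod N such that σ(x) = x + c for all x. In particular, the group of such relation-preserving permutations has exactly N = n·m + 1 elements. -/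
/-- The relation `R_j` on `ZMod N`: `R_j(a,b)` iff `j·m + 1 ≤ (a - b).val ≤ (j+1)·m`. -/
def circRel (N m j : ℕ) (a b : ZMod N) : Prop :=
  j * m + 1 ≤ (a - b).val ∧ (a - b).val ≤ (j + 1) * m

theorem circRel_zero_iff {N m : ℕ} {a b : ZMod N} :
    circRel N m 0 a b ↔ 1 ≤ (a - b).val ∧ (a - b).val ≤ m := by
  simp [circRel]

theorem circRel_add_right {N m j : ℕ} (a b c : ZMod N) :
    circRel N m j (a + c) (b + c) ↔ circRel N m j a b := by
  simp [circRel]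

/-- If `2m < N`, the successor relation on `ZMod N` is the covering relation of `R_0`. -/
theorem eq_add_one_iff_circRel_zero {N m : ℕ} (hm : 1 ≤ m) (hN : 2 * m < N) (a b : ZMod N) :
    a = b + 1 ↔ circRel N m 0 a b ∧ ∀ c, circRel N m 0 a c → ¬ circRel N m 0 c b := by
  have : Fact (1 < N) := ⟨by omega⟩
  have : NeZero N := ⟨by omega⟩
  have val_one : (1 : ZMod N).val = 1 := ZMod.val_one N
  simp only [circRel_zero_iff]
  constructor
  · rintro rfl
    refine ⟨by simp [val_one, hm], fun c hac hcb => ?_⟩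
    have h := ZMod.val_add_of_lt (a := b + 1 - c) (b := c - b) (by omega)
    rw [sub_add_sub_cancel, add_sub_cancel_left, val_one] at h
    omega
  · rintro ⟨hab, hcover⟩
    have hsub : (a - (b + 1)).val = (a - b).val - 1 := by
      rw [← sub_sub, ZMod.val_sub (by omega), val_one]
    have hle : (a - b).val ≤ 1 := by
      by_contra! hlt
      exact hcover (b + 1) (by omega) (by simp [val_one, hm])
    rw [← sub_eq_zero, ← ZMod.val_eq_zero]
    omega

theorem ZMod.apply_eq_add_of_apply_add_one {N : ℕ} [NeZero N] {f : ZMod N → ZMod N}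
    (hf : ∀ x, f (x + 1) = f x + 1) (x : ZMod N) : f x = x + f 0 := by
  have h (k : ℕ) : f k = k + f 0 := by
    induction k with
    | zero => simp
    | succ k ih => rw [Nat.cast_succ, hf, ih]; ring
  simpa using h x.val

theorem circRel_preserving_iff_rotation {n m : ℕ} (hn : 2 ≤ n) (hm : 1 ≤ m)
    (σ : Equiv.Perm (ZMod (n * m + 1))) :
    (∀ j < n, ∀ a b : ZMod (n * m + 1),
      circRel (n * m + 1) m j a b ↔ circRel (n * m + 1) m j (σ a) (σ b)) ↔
    ∃ c : ZMod (n * m + 1), ∀ x, σ x = x + c := by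
  constructor
  · intro h
    have hN : 2 * m < n * m + 1 := Nat.lt_succ_of_le (Nat.mul_le_mul_right m hn)
    refine ⟨σ 0, ZMod.apply_eq_add_of_apply_add_one fun x => ?_⟩
    have h₀ := h 0 (by omega)
    obtain ⟨hrel, hcover⟩ := (eq_add_one_iff_circRel_zero hm hN (x + 1) x).1 rfl
    exact (eq_add_one_iff_circRel_zero hm hN _ _).2 ⟨(h₀ _ _).1 hrel,
      σ.surjective.forall.2 fun c hac hcb => hcover c ((h₀ _ _).2 hac) ((h₀ _ _).2 hcb)⟩
  · rintro ⟨c, hc⟩ j - a b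
    rw [hc, hc, circRel_add_right]

theorem card_rotations (G : Type*) [AddGroup G] :
    Nat.card {σ : Equiv.Perm G // ∃ c, ∀ x, σ x = x + c} = Nat.card G := by
  refine (Nat.card_congr (Equiv.ofBijective
    (fun c => ⟨Equiv.addRight c, c, fun _ => rfl⟩) ⟨fun c d h => ?_, ?_⟩)).symm
  · simpa using Equiv.congr_fun (congrArg Subtype.val h) 0
  · rintro ⟨σ, c, hc⟩
    exact ⟨c, Subtype.ext (Equiv.ext fun x => (hc x).symm)⟩

/-- For `n ≥ 2`, `m ≥ 1` and `N = n·m + 1`, a permutation `σ` of `ZMod N`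
preserves all the relations `R_j` (`j < n`) if and only if it is a rotation `x ↦ x + c`;
in particular there are exactly `N` such permutations. -/
theorem rel_preserving_perm_iff_rotation (n m : ℕ) (hn : 2 ≤ n) (hm : 1 ≤ m) :
    (∀ σ : Equiv.Perm (ZMod (n * m + 1)),
      (∀ j < n, ∀ a b : ZMod (n * m + 1),
        circRel (n * m + 1) m j a b ↔ circRel (n * m + 1) m j (σ a) (σ b)) ↔
      ∃ c : ZMod (n * m + 1), ∀ x, σ x = x + c) ∧
    Nat.card {σ : Equiv.Perm (ZMod (n * m + 1)) //
        ∀ j < n, ∀ a b : ZMod (n * m + 1),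
          circRel (n * m + 1) m j a b ↔ circRel (n * m + 1) m j (σ a) (σ b)} =
      n * m + 1 := by
  refine ⟨circRel_preserving_iff_rotation hn hm, ?_⟩
  simp only [circRel_preserving_iff_rotation hn hm]
  rw [card_rotations, Nat.card_zmod]
end

section
/- Let n ≥ 1, m ≥ 1, j < n and N' ≤ m be natural numbers. For every function c : Fin N' → Fin n there exists a strictly monotone function f : Fin N' → Fin (n·m + 1) such that for every a : Fin N', (f a).val ≡ (c a).val + j (mod n). -/
/-- For `n, m ≥ 1`, `j < n` and `N' ≤ m`, every labeling
`c : Fin N' → Fin n` of a linear order with `N'` points by `n` parts is realized by a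
strictly monotone map into `Fin (n·m + 1)` landing, at each point `a`, in the residue class
`c a + j (mod n)`. -/
theorem partitioned_linear_order_embeds (n m j N' : ℕ) (hn : 1 ≤ n) (hm : 1 ≤ m)
    (hj : j < n) (hN : N' ≤ m) (c : Fin N' → Fin n) :
    ∃ f : Fin N' → Fin (n * m + 1), StrictMono f ∧
      ∀ a : Fin N', (f a).val ≡ (c a).val + j [MOD n] := by
  have hr (a : Fin N') : ((c a).val + j) % n < n := Nat.mod_lt _ hn
  have hle {a b : ℕ} (h : a < b) : n * a + n ≤ n * b := Nat.mul_le_mul_left n h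
  refine ⟨fun a => ⟨n * a.val + ((c a).val + j) % n, ?_⟩, fun a b hab => ?_, fun a => ?_⟩
  · have := hr a
    have := hle (a.isLt.trans_le hN)
    omega
  · have := hr a
    have := hle (Fin.lt_def.mp hab)
    simp only [Fin.mk_lt_mk]
    omega
  · simp [Nat.ModEq]
end
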